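/- arXiv:1206.0313 — 3 statements merged into one kernel-verified Lean document; each statement's English description precedes it below -/
import Mathlib

section
/- If the columns of X ∈ ℝ^{n×p} are in general position, then for every y ∈ ℝⁿ and every λ > 0, the lasso problem has a unique solution; moreover, the columns of X indexed by the equicorrelation set E are linearly independent, so the unique solution satisfies β̂ᵢ = 0 for i ∉ E and β̂_E = (X_Eᵀ X_E)⁻¹ (X_Eᵀ y − λ s). -/
open Matrix BigOperators Filter MeasureTheory

/-- The lasso criterion: (1/2)‖y − Xβ‖₂² + λ‖β‖₁. -/
noncomputable def lassoObj {n p : ℕ} (y : Fin n → ℝ) (X : Matrix (Fin n) (Fin p) ℝ)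
    (lam : ℝ) (β : Fin p → ℝ) : ℝ :=
  (1 / 2) * ∑ j, (y j - X.mulVec β j) ^ 2 + lam * ∑ i, |β i|

/-- A lasso solution: a minimizer of the lasso criterion. -/
def IsLassoSol {n p : ℕ} (y : Fin n → ℝ) (X : Matrix (Fin n) (Fin p) ℝ)
    (lam : ℝ) (b : Fin p → ℝ) : Prop :=
  ∀ β : Fin p → ℝ, lassoObj y X lam b ≤ lassoObj y X lam β

/-- Inner product of the i-th column of X with the residual y − Xb. -/
noncomputable def corr {n p : ℕ} (y : Fin n → ℝ) (X : Matrix (Fin n) (Fin p) ℝ)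
    (b : Fin p → ℝ) (i : Fin p) : ℝ :=
  ∑ j, X j i * (y j - X.mulVec b j)

open Classical in
/-- The equicorrelation set E = {i : |X_iᵀ(y − Xb)| = λ}, defined from a solution b. -/
noncomputable def equiSet {n p : ℕ} (y : Fin n → ℝ) (X : Matrix (Fin n) (Fin p) ℝ)
    (lam : ℝ) (b : Fin p → ℝ) : Finset (Fin p) :=
  Finset.univ.filter fun i => |corr y X b i| = lam

/-- The submatrix of X with columns indexed by E. -/
def colSub {n p : ℕ} (X : Matrix (Fin n) (Fin p) ℝ) (E : Finset (Fin p)) :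
    Matrix (Fin n) E ℝ :=
  fun j i => X j i

/-- Columns of X are in general position: for every k < n, any k+1 distinct
signed columns have an affine span containing no other (signed) column of X. -/
def InGeneralPosition {n p : ℕ} (X : Matrix (Fin n) (Fin p) ℝ) : Prop :=
  ∀ k : ℕ, k < n → ∀ I : Finset (Fin p), I.card = k + 1 →
    ∀ σ : Fin p → ℝ, (∀ i, σ i = 1 ∨ σ i = -1) →
      ∀ i ∉ I, ∀ ε : ℝ, ε = 1 ∨ ε = -1 →
        ε • (fun j => X j i : Fin n → ℝ) ∉
          affineSpan ℝ ((fun m => σ m • (fun j => X j m : Fin n → ℝ)) '' (I : Set (Fin p)))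

lemma lasso_shift {n p : ℕ} (y : Fin n → ℝ) (X : Matrix (Fin n) (Fin p) ℝ)
    (lam : ℝ) (b : Fin p → ℝ) (i : Fin p) (t : ℝ) :
    lassoObj y X lam (b + Pi.single i t) = lassoObj y X lam b - t * corr y X b i
      + t ^ 2 * ((1/2) * ∑ j, X j i ^ 2) + lam * (|b i + t| - |b i|) := by
  have h1 : ∑ k, |(b + Pi.single i t : Fin p → ℝ) k| = ∑ k, |b k| + (|b i + t| - |b i|) := by
    rw [← Finset.add_sum_erase _ _ (Finset.mem_univ i),
      ← Finset.add_sum_erase _ (fun k => |b k|) (Finset.mem_univ i)]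
    have : ∑ k ∈ Finset.univ.erase i, |(b + Pi.single i t : Fin p → ℝ) k|
        = ∑ k ∈ Finset.univ.erase i, |b k| := by
      apply Finset.sum_congr rfl
      intro k hk
      have : k ≠ i := Finset.ne_of_mem_erase hk
      simp [this]
    rw [this]
    simp
    ring
  have h2 : ∑ j, (y j - X.mulVec (b + Pi.single i t) j) ^ 2
      = ∑ j, (y j - X.mulVec b j) ^ 2 - 2 * t * corr y X b i + t ^ 2 * ∑ j, X j i ^ 2 := by
    unfold corr
    rw [Finset.mul_sum, Finset.mul_sum, ← Finset.sum_sub_distrib, ← Finset.sum_add_distrib]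
    apply Finset.sum_congr rfl
    intro j _
    rw [Matrix.mulVec_add]
    simp
    ring
  unfold lassoObj
  rw [h1, h2]
  ring

lemma lin_zero (a q B : ℝ) (hB : 0 < B) (h : ∀ t : ℝ, |t| ≤ B → 0 ≤ t * a + t ^ 2 * q) :
    a = 0 := by
  by_contra ha
  have hapos : 0 < |a| := abs_pos.mpr ha
  set e := min (B / |a|) (1 / (2 * (|q| + 1))) with he
  have hq : 0 < |q| + 1 := by positivity
  have hepos : 0 < e := lt_min (by positivity) (by positivity)
  have h1 : e * |a| ≤ B := by
    have := min_le_left (B / |a|) (1 / (2 * (|q| + 1)))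
    rwa [← he, le_div_iff₀ hapos] at this
  have h2 : e * (2 * (|q| + 1)) ≤ 1 := by
    have := min_le_right (B / |a|) (1 / (2 * (|q| + 1)))
    rwa [← he, le_div_iff₀ (by positivity)] at this
  have := h (-(e * a)) (by rw [abs_neg, abs_mul, abs_of_pos hepos]; exact h1)
  have h3 : e * q < 1 := by nlinarith [le_abs_self q, abs_nonneg q]
  have h4 : 0 < e * a ^ 2 := by positivity
  nlinarith

lemma lasso_kkt {n p : ℕ} {y : Fin n → ℝ} {X : Matrix (Fin n) (Fin p) ℝ}
    {lam : ℝ} (hlam : 0 < lam) {b : Fin p → ℝ} (hb : IsLassoSol y X lam b) (i : Fin p)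
    (hi : b i ≠ 0) : |corr y X b i| = lam := by
  have key : ∀ t, 0 ≤ - t * corr y X b i
      + t ^ 2 * ((1/2) * ∑ j, X j i ^ 2) + lam * (|b i + t| - |b i|) := by
    intro t
    have := hb (b + Pi.single i t)
    rw [lasso_shift] at this
    linarith
  rcases lt_or_gt_of_ne hi with h | h
  · have : -lam - corr y X b i = 0 := by
      apply lin_zero _ ((1/2) * ∑ j, X j i ^ 2) (-b i) (by linarith)
      intro t ht
      have h1 := key t
      rw [abs_le] at ht
      rw [abs_of_neg h, abs_of_nonpos (by linarith)] at h1
      linarith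
    rw [show corr y X b i = -lam by linarith, abs_neg, abs_of_pos hlam]
  · have : lam - corr y X b i = 0 := by
      apply lin_zero _ ((1/2) * ∑ j, X j i ^ 2) (b i) h
      intro t ht
      have h1 := key t
      rw [abs_le] at ht
      rw [abs_of_pos h, abs_of_nonneg (by linarith)] at h1
      linarith
    rw [show corr y X b i = lam by linarith, abs_of_pos hlam]

lemma lasso_exists {n p : ℕ} (y : Fin n → ℝ) (X : Matrix (Fin n) (Fin p) ℝ)
    (lam : ℝ) (hlam : 0 < lam) : ∃ b, IsLassoSol y X lam b := by
  have hc : Continuous (lassoObj y X lam) := by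
    unfold lassoObj Matrix.mulVec dotProduct
    fun_prop
  have h0 : 0 ≤ lassoObj y X lam 0 := by
    unfold lassoObj; positivity
  obtain ⟨b, hb, hmin⟩ := (isCompact_closedBall (0 : Fin p → ℝ)
    (lassoObj y X lam 0 / lam)).exists_isMinOn ⟨0, by simp; positivity⟩ hc.continuousOn
  refine ⟨b, fun β => ?_⟩
  by_cases hβ : β ∈ Metric.closedBall (0 : Fin p → ℝ) (lassoObj y X lam 0 / lam)
  · exact hmin hβ
  · have h1 : lassoObj y X lam b ≤ lassoObj y X lam 0 := hmin (by simp; positivity)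
    refine h1.trans ?_
    by_contra hlt
    push Not at hlt
    apply hβ
    rw [mem_closedBall_zero_iff, pi_norm_le_iff_of_nonneg (by positivity)]
    intro i
    rw [le_div_iff₀ hlam, Real.norm_eq_abs]
    have h2 : |β i| ≤ ∑ k, |β k| :=
      Finset.single_le_sum (f := fun k => |β k|) (fun k _ => abs_nonneg _) (Finset.mem_univ i)
    have h3 : 0 ≤ ∑ j, (y j - X.mulVec β j) ^ 2 := by positivity
    unfold lassoObj at hlt ⊢
    nlinarith

lemma lasso_fit {n p : ℕ} {y : Fin n → ℝ} {X : Matrix (Fin n) (Fin p) ℝ}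
    {lam : ℝ} (hlam : 0 < lam) {b c : Fin p → ℝ} (hb : IsLassoSol y X lam b)
    (hc : IsLassoSol y X lam c) : X.mulVec b = X.mulVec c := by
  have h1 := hb ((1/2 : ℝ) • (b + c))
  have h2 := hc ((1/2 : ℝ) • (b + c))
  have e1 : ∑ j, (y j - X.mulVec ((1/2 : ℝ) • (b + c)) j) ^ 2
      = (1/2) * ∑ j, (y j - X.mulVec b j) ^ 2 + (1/2) * ∑ j, (y j - X.mulVec c j) ^ 2
        - (1/4) * ∑ j, (X.mulVec b j - X.mulVec c j) ^ 2 := by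
    rw [Finset.mul_sum, Finset.mul_sum, Finset.mul_sum, ← Finset.sum_add_distrib,
      ← Finset.sum_sub_distrib]
    apply Finset.sum_congr rfl
    intro j _
    rw [Matrix.mulVec_smul, Matrix.mulVec_add]
    simp only [Pi.smul_apply, Pi.add_apply, smul_eq_mul]
    ring
  have e2 : ∑ i, |((1/2 : ℝ) • (b + c)) i| ≤ (1/2) * ∑ i, |b i| + (1/2) * ∑ i, |c i| := by
    rw [Finset.mul_sum, Finset.mul_sum, ← Finset.sum_add_distrib]
    apply Finset.sum_le_sum
    intro i _
    simp only [Pi.smul_apply, Pi.add_apply, smul_eq_mul]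
    rw [abs_mul, abs_of_pos (by norm_num : (0:ℝ) < 1/2)]
    linarith [abs_add_le (b i) (c i)]
  have e3 := mul_le_mul_of_nonneg_left e2 hlam.le
  unfold lassoObj at h1 h2
  rw [e1] at h1 h2
  have h0 : ∑ j, (X.mulVec b j - X.mulVec c j) ^ 2 = 0 := by
    apply le_antisymm
    · linarith
    · positivity
  rw [Finset.sum_eq_zero_iff_of_nonneg (fun j _ => sq_nonneg _)] at h0
  funext j
  have := h0 j (Finset.mem_univ j)
  have := pow_eq_zero_iff (two_ne_zero) |>.mp this
  linarith

lemma lasso_indep {n p : ℕ} (X : Matrix (Fin n) (Fin p) ℝ) (hgp : InGeneralPosition X)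
    (y : Fin n → ℝ) (lam : ℝ) (hlam : 0 < lam) (b : Fin p → ℝ) :
    LinearIndependent ℝ
        (fun i : ↥(equiSet y X lam b) => (fun j => X j i.1 : Fin n → ℝ)) := by
  classical
  set E := equiSet y X lam b with hE
  let r : Fin n → ℝ := fun j => y j - X.mulVec b j
  let σ : Fin p → ℝ := fun i => if 0 ≤ corr y X b i then 1 else -1
  have hσ : ∀ i, σ i = 1 ∨ σ i = -1 := by
    intro i; simp only [σ]; split_ifs <;> simp
  let v : Fin p → Fin n → ℝ := fun m => σ m • (fun j => X j m : Fin n → ℝ)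
  have hv : ∀ i ∈ E, v i ⬝ᵥ r = lam := by
    intro i hi
    have hc : |corr y X b i| = lam := by simpa [hE, equiSet] using hi
    have : (fun j => X j i : Fin n → ℝ) ⬝ᵥ r = corr y X b i := rfl
    simp only [v, smul_dotProduct, this, σ, smul_eq_mul]
    split_ifs with h
    · rw [← hc, abs_of_nonneg h]; ring
    · rw [← hc, abs_of_neg (not_le.mp h)]; ring
  obtain ⟨I, hIE, -, hspan, hI⟩ := exists_linearIndepOn_extension
    (K := ℝ) (v := v) (s := ∅) (t := (E : Set (Fin p))) (by simp) (by simp)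
  obtain ⟨I, rfl⟩ := (I.toFinite).exists_finset_coe
  have hEI : E = I := by
    by_contra hne
    have hss : I ⊂ E := lt_of_le_of_ne (by exact_mod_cast hIE) (Ne.symm hne)
    obtain ⟨i0, hi0, hi0I⟩ := Finset.exists_of_ssubset hss
    have hm := hspan ⟨i0, hi0, rfl⟩
    obtain ⟨a, ha⟩ : ∃ a : Fin p → ℝ, ∑ i ∈ I, a i • v i = v i0 := by
      obtain ⟨a, ha⟩ := (Submodule.mem_span_image_finset_iff_exists_fun ℝ).mp hm
      refine ⟨fun i => if h : i ∈ I then a ⟨i, h⟩ else 0, ?_⟩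
      rw [← ha, ← Finset.sum_coe_sort I]
      apply Finset.sum_congr rfl
      intro i _
      simp
    have hsum : ∑ i ∈ I, a i = 1 := by
      have h1 := congrArg (fun w => w ⬝ᵥ r) ha
      simp only [sum_dotProduct, smul_dotProduct, smul_eq_mul] at h1
      rw [hv i0 hi0, Finset.sum_congr rfl
        (fun i hi => by rw [hv i (hss.1 hi)]), ← Finset.sum_mul] at h1
      exact mul_right_cancel₀ hlam.ne' (by rw [h1, one_mul])
    have hpos : 0 < I.card := by
      rw [Finset.card_pos, Finset.nonempty_iff_ne_empty]
      rintro rfl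
      simp at hsum
    have hcard : I.card ≤ n := by
      have := hI.linearIndependent.fintype_card_le_finrank
      simpa using this
    refine hgp (I.card - 1) (by omega) I (by omega) σ hσ i0 hi0I (σ i0) (hσ i0) ?_
    change v i0 ∈ affineSpan ℝ (v '' (I : Set (Fin p)))
    rw [← ha, ← Finset.affineCombination_eq_linear_combination _ _ _ hsum]
    exact affineCombination_mem_affineSpan_image hsum (by simp; tauto) _
  rw [← hEI] at hI
  have hli : LinearIndependent ℝ (fun i : E => v i.1) := hI
  rw [Fintype.linearIndependent_iff] at hli ⊢
  intro g hg i
  have hs : ∀ m, σ m * σ m = 1 := by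
    intro m; rcases hσ m with h | h <;> simp [h]
  have h2 := hli (fun i => g i * σ i.1) (by
    rw [← hg]
    apply Finset.sum_congr rfl
    intro i _
    simp only [v, smul_smul, mul_assoc, hs, mul_one]) i
  have h3 : g i = g i * σ i.1 * σ i.1 := by rw [mul_assoc, hs, mul_one]
  rw [h3, h2, zero_mul]

/-- If the columns of X are in general position, then for every y
and λ > 0 the lasso solution is unique; moreover the columns indexed by the
equicorrelation set E are linearly independent and the unique solution is
β̂_{-E} = 0, β̂_E = (X_EᵀX_E)⁻¹(X_Eᵀy − λs). -/
theorem stmt6 {n p : ℕ} (X : Matrix (Fin n) (Fin p) ℝ) (hgp : InGeneralPosition X)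
    (y : Fin n → ℝ) (lam : ℝ) (hlam : 0 < lam) :
    (∃! b : Fin p → ℝ, IsLassoSol y X lam b) ∧
    ∀ b : Fin p → ℝ, IsLassoSol y X lam b →
      LinearIndependent ℝ
        (fun i : ↥(equiSet y X lam b) => (fun j => X j i.1 : Fin n → ℝ)) ∧
      (∀ i ∉ equiSet y X lam b, b i = 0) ∧
      (fun i : ↥(equiSet y X lam b) => b i.1) =
        (((colSub X (equiSet y X lam b))ᵀ * colSub X (equiSet y X lam b))⁻¹).mulVec
          ((colSub X (equiSet y X lam b))ᵀ.mulVec y -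
            lam • (fun i : ↥(equiSet y X lam b) => Real.sign (corr y X b i.1))) := by
  have hzero : ∀ b : Fin p → ℝ, IsLassoSol y X lam b → ∀ i ∉ equiSet y X lam b, b i = 0 := by
    intro b hb i hi
    by_contra h
    exact hi (by simpa [equiSet] using lasso_kkt hlam hb i h)
  have hsumE : ∀ (E : Finset (Fin p)) (d : Fin p → ℝ), (∀ i ∉ E, d i = 0) → ∀ j,
      X.mulVec d j = ∑ i : E, X j i.1 * d i.1 := by
    intro E d hd j
    rw [Finset.sum_coe_sort E (fun i => X j i * d i)]
    symm
    apply Finset.sum_subset (Finset.subset_univ _)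
    intro i _ hi
    rw [hd i hi, mul_zero]
  refine ⟨?_, ?_⟩
  · obtain ⟨b, hb⟩ := lasso_exists y X lam hlam
    refine ⟨b, hb, fun c hc => ?_⟩
    have hfit := lasso_fit hlam hc hb
    have hE : equiSet y X lam c = equiSet y X lam b := by
      unfold equiSet corr
      rw [hfit]
    have hli := lasso_indep X hgp y lam hlam b
    rw [Fintype.linearIndependent_iff] at hli
    have hc0 := hzero c hc
    rw [hE] at hc0
    have hd : ∀ i ∉ equiSet y X lam b, (c - b) i = 0 := by
      intro i hi
      rw [Pi.sub_apply, hc0 i hi, hzero b hb i hi, sub_zero]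
    have h1 := hli (fun i => (c - b) i.1) (by
      funext j
      have h2 := hsumE _ _ hd j
      rw [Matrix.mulVec_sub, hfit, sub_self] at h2
      rw [Finset.sum_apply, h2]
      exact Finset.sum_congr rfl (fun i _ => mul_comm _ _))
    funext i
    by_cases hi : i ∈ equiSet y X lam b
    · exact sub_eq_zero.mp (h1 ⟨i, hi⟩)
    · rw [hc0 i hi, hzero b hb i hi]
  · intro b hb
    have hli := lasso_indep X hgp y lam hlam b
    refine ⟨hli, hzero b hb, ?_⟩
    have hbE := hsumE _ _ (hzero b hb)
    have hmemE : ∀ i ∈ equiSet y X lam b, |corr y X b i| = lam := by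
      intro i hi; simpa [equiSet] using hi
    generalize equiSet y X lam b = E at hli hbE hmemE ⊢
    have hinj : Function.Injective (colSub X E).mulVec :=
      Matrix.mulVec_injective_iff.mpr hli
    have hpd : ((colSub X E)ᵀ * colSub X E).PosDef := by
      have := Matrix.PosDef.conjTranspose_mul_self (colSub X E) hinj
      rwa [Matrix.conjTranspose_eq_transpose_of_trivial] at this
    have hu : IsUnit ((colSub X E)ᵀ * colSub X E).det := (Matrix.isUnit_iff_isUnit_det _).mp hpd.isUnit
    have hfit : (colSub X E).mulVec (fun i : E => b i.1) = X.mulVec b := by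
      funext j
      rw [hbE j]; rfl
    have hnorm : (colSub X E)ᵀ.mulVec y - lam • (fun i : E => Real.sign (corr y X b i.1))
        = ((colSub X E)ᵀ * colSub X E).mulVec (fun i : E => b i.1) := by
      rw [← Matrix.mulVec_mulVec, hfit, sub_eq_iff_eq_add, ← sub_eq_iff_eq_add',
        ← Matrix.mulVec_sub]
      funext i
      have h1 : ((colSub X E)ᵀ.mulVec (y - X.mulVec b)) i = corr y X b i.1 := rfl
      rw [h1, Pi.smul_apply, smul_eq_mul]
      have h2 := hmemE i.1 i.2
      rcases lt_trichotomy (corr y X b i.1) 0 with h | h | h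
      · rw [Real.sign_of_neg h]; rw [abs_of_neg h] at h2; linarith
      · rw [h, abs_zero] at h2; linarith
      · rw [Real.sign_of_pos h]; rw [abs_of_pos h] at h2; linarith
    rw [hnorm, Matrix.mulVec_mulVec, Matrix.nonsing_inv_mul _ hu, Matrix.one_mulVec]
end

section
/- Fix X ∈ ℝ^{n×p} and λ > 0. For Lebesgue-almost every y ∈ ℝⁿ, there exists a lasso solution β̂ whose support supp(β̂) = {i : β̂ᵢ ≠ 0} equals the equicorrelation set E; since every lasso solution has support contained in E, this solution achieves the largest support of any lasso solution. -/
open Matrix BigOperators Filter MeasureTheory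

def KKT {n p : ℕ} (y : Fin n → ℝ) (X : Matrix (Fin n) (Fin p) ℝ)
    (lam : ℝ) (b : Fin p → ℝ) : Prop :=
  ∀ i, |corr y X b i| ≤ lam ∧ corr y X b i * b i = lam * |b i|

lemma corr_dot {n p : ℕ} (y : Fin n → ℝ) (X : Matrix (Fin n) (Fin p) ℝ)
    (b d : Fin p → ℝ) :
    ∑ i, corr y X b i * d i = ∑ j, (y j - X.mulVec b j) * X.mulVec d j := by
  simp only [corr, Matrix.mulVec, dotProduct, Finset.sum_mul, Finset.mul_sum]
  rw [Finset.sum_comm]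
  refine Finset.sum_congr rfl fun j _ => Finset.sum_congr rfl fun i _ => ?_
  ring

lemma obj_diff {n p : ℕ} (y : Fin n → ℝ) (X : Matrix (Fin n) (Fin p) ℝ)
    (lam : ℝ) (b d : Fin p → ℝ) :
    lassoObj y X lam (b + d) - lassoObj y X lam b =
      (1 / 2) * ∑ j, (X.mulVec d j) ^ 2 +
        ∑ i, (lam * |b i + d i| - lam * |b i| - corr y X b i * d i) := by
  simp only [Finset.sum_sub_distrib, corr_dot, ← Finset.mul_sum]
  simp only [lassoObj, Matrix.mulVec_add, Pi.add_apply]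
  have : ∀ j, (y j - (X.mulVec b j + X.mulVec d j)) ^ 2 =
      (y j - X.mulVec b j) ^ 2 + (X.mulVec d j) ^ 2
        - 2 * ((y j - X.mulVec b j) * X.mulVec d j) := fun j => by ring
  simp only [this, Finset.sum_add_distrib, Finset.sum_sub_distrib, ← Finset.mul_sum]
  ring

lemma scal_le {K a : ℝ} (h : ∀ t : ℝ, 0 < t → t ≤ 1 → 0 ≤ t ^ 2 * K + t * a) : 0 ≤ a := by
  by_contra! ha
  have hK : 0 < |K| + 1 := by positivity
  have hd : 0 < -a / (|K| + 1 - a) := div_pos (by linarith) (by linarith)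
  have hd1 : -a / (|K| + 1 - a) ≤ 1 := by
    rw [div_le_one (by linarith)]; linarith
  have h1 := h _ hd hd1
  set t := -a / (|K| + 1 - a) with ht
  have h2 : t * (|K| + 1 - a) = -a := by
    rw [ht]; exact div_mul_cancel₀ _ (by linarith)
  have h3 : 0 ≤ t * K + a := by
    by_contra! hh
    nlinarith
  nlinarith [le_abs_self K]

lemma kkt_of_sol {n p : ℕ} {y : Fin n → ℝ} {X : Matrix (Fin n) (Fin p) ℝ}
    {lam : ℝ} (hlam : 0 < lam) {b : Fin p → ℝ} (h : IsLassoSol y X lam b) :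
    KKT y X lam b := by
  intro i
  obtain ⟨K, hK⟩ : ∃ K : ℝ, ∀ t : ℝ, 0 ≤ t ^ 2 * K +
      (lam * |b i + t| - lam * |b i| - corr y X b i * t) := by
    refine ⟨(1 / 2) * ∑ j, (X.mulVec (Pi.single i 1) j) ^ 2, fun t => ?_⟩
    have h1 := h (b + t • Pi.single i 1)
    have h2 := obj_diff y X lam b (t • Pi.single i 1)
    rw [Finset.sum_eq_single i] at h2
    · simp only [Matrix.mulVec_smul, Pi.smul_apply, smul_eq_mul, mul_pow, ← Finset.mul_sum,
        Pi.single_eq_same, mul_one] at h2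
      linarith
    · intro k _ hk
      simp [Pi.single_eq_of_ne hk]
    · simp
  have hA : ∀ s : ℝ, |s| = 1 → 0 ≤ lam - corr y X b i * s := by
    intro s hs
    refine scal_le (K := K) fun t ht _ => ?_
    have h1 := hK (t * s)
    have h2 : |b i + t * s| ≤ |b i| + t := by
      refine (abs_add_le _ _).trans ?_
      rw [abs_mul, hs, abs_of_pos ht, mul_one]
    have h3 : s ^ 2 = 1 := by rw [← sq_abs, hs]; norm_num
    rw [mul_pow, h3] at h1
    nlinarith
  have h1 := hA 1 (by simp)
  have h2 := hA (-1) (by simp)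
  have h3 : |corr y X b i| ≤ lam := abs_le.2 ⟨by linarith, by linarith⟩
  refine ⟨h3, le_antisymm ?_ ?_⟩
  · refine (le_abs_self _).trans ?_
    rw [abs_mul]
    gcongr
  · have : 0 ≤ corr y X b i * b i - lam * |b i| := by
      refine scal_le (K := b i ^ 2 * K) fun t ht ht1 => ?_
      have h1 := hK (-(t * b i))
      have h2 : |b i + -(t * b i)| = (1 - t) * |b i| := by
        rw [show b i + -(t * b i) = (1 - t) * b i by ring, abs_mul,
          abs_of_nonneg (by linarith)]
      rw [h2] at h1
      nlinarith
    linarith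

lemma term_nonneg {lam g x : ℝ} (hg : |g| ≤ lam) : 0 ≤ lam * |x| - g * x := by
  have : g * x ≤ lam * |x| := by
    refine (le_abs_self _).trans ?_
    rw [abs_mul]
    gcongr
  linarith

lemma obj_diff_kkt {n p : ℕ} {y : Fin n → ℝ} {X : Matrix (Fin n) (Fin p) ℝ}
    {lam : ℝ} {b : Fin p → ℝ} (h : KKT y X lam b) (β : Fin p → ℝ) :
    lassoObj y X lam β - lassoObj y X lam b =
      (1 / 2) * ∑ j, (X.mulVec (β - b) j) ^ 2 +
        ∑ i, (lam * |β i| - corr y X b i * β i) := by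
  have h1 := obj_diff y X lam b (β - b)
  rw [add_sub_cancel] at h1
  rw [h1]
  congr 1
  refine Finset.sum_congr rfl fun i _ => ?_
  have := (h i).2
  simp only [Pi.sub_apply, add_sub_cancel]
  linarith

lemma sol_of_kkt {n p : ℕ} {y : Fin n → ℝ} {X : Matrix (Fin n) (Fin p) ℝ}
    {lam : ℝ} {b : Fin p → ℝ} (h : KKT y X lam b) : IsLassoSol y X lam b := by
  intro β
  have h1 := obj_diff_kkt h β
  have h2 : 0 ≤ ∑ i, (lam * |β i| - corr y X b i * β i) :=
    Finset.sum_nonneg fun i _ => term_nonneg (h i).1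
  have h3 : 0 ≤ ∑ j, (X.mulVec (β - b) j) ^ 2 := Finset.sum_nonneg fun j _ => sq_nonneg _
  linarith

lemma supp_sub {n p : ℕ} {y : Fin n → ℝ} {X : Matrix (Fin n) (Fin p) ℝ}
    {lam : ℝ} (hlam : 0 < lam) {b b' : Fin p → ℝ} (h : IsLassoSol y X lam b)
    (h' : IsLassoSol y X lam b') (i : Fin p) (hi : b' i ≠ 0) : |corr y X b i| = lam := by
  have hk := kkt_of_sol hlam h
  have h1 := obj_diff_kkt hk b'
  have h3 : 0 ≤ ∑ j, (X.mulVec (b' - b) j) ^ 2 := Finset.sum_nonneg fun j _ => sq_nonneg _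
  have h4 := h' b
  have h5 : lam * |b' i| - corr y X b i * b' i ≤ ∑ i, (lam * |b' i| - corr y X b i * b' i) :=
    Finset.single_le_sum (f := fun i => lam * |b' i| - corr y X b i * b' i)
      (fun i _ => term_nonneg (hk i).1) (Finset.mem_univ i)
  have h6 : lam * |b' i| ≤ |corr y X b i| * |b' i| := by
    rw [← abs_mul]
    exact le_trans (by linarith) (le_abs_self _)
  exact le_antisymm (hk i).1 (le_of_mul_le_mul_right h6 (abs_pos.2 hi))

lemma exists_sol {n p : ℕ} (y : Fin n → ℝ) (X : Matrix (Fin n) (Fin p) ℝ)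
    {lam : ℝ} (hlam : 0 < lam) : ∃ b, IsLassoSol y X lam b := by
  have hc : Continuous (lassoObj y X lam) := by
    unfold lassoObj Matrix.mulVec dotProduct
    fun_prop
  refine hc.exists_forall_le ?_
  have h1 : Tendsto (fun β : Fin p → ℝ => lam * ‖β‖) (cocompact _) atTop :=
    (tendsto_norm_cocompact_atTop).const_mul_atTop hlam
  refine tendsto_atTop_mono (fun β => ?_) h1
  have h3 : 0 ≤ ∑ j, (y j - X.mulVec β j) ^ 2 := Finset.sum_nonneg fun j _ => sq_nonneg _
  have h4 : ‖β‖ ≤ ∑ i, |β i| := by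
    refine (pi_norm_le_iff_of_nonneg (Finset.sum_nonneg fun i _ => abs_nonneg _)).2 fun i => ?_
    exact Finset.single_le_sum (f := fun i => |β i|) (fun i _ => abs_nonneg _) (Finset.mem_univ i)
  have := mul_le_mul_of_nonneg_left h4 hlam.le
  unfold lassoObj
  linarith

open Classical in
noncomputable def spt {p : ℕ} (b : Fin p → ℝ) : Finset (Fin p) :=
  Finset.univ.filter fun i => b i ≠ 0

lemma enlarge {n p : ℕ} {y : Fin n → ℝ} {X : Matrix (Fin n) (Fin p) ℝ}
    {lam : ℝ} (hlam : 0 < lam) {b : Fin p → ℝ} (h : IsLassoSol y X lam b)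
    (j : Fin p) (hj : b j = 0) (hE : |corr y X b j| = lam)
    (c : Fin p → ℝ) (hc : ∀ i, b i = 0 → c i = 0)
    (hX : X.mulVec (Pi.single j 1 - c) = 0) :
    ∃ b', IsLassoSol y X lam b' ∧ (spt b).card < (spt b').card := by
  have hk := kkt_of_sol hlam h
  set g := corr y X b j with hg
  set d : Fin p → ℝ := g • (Pi.single j 1 - c) with hd
  have hXd : X.mulVec d = 0 := by rw [hd, Matrix.mulVec_smul, hX, smul_zero]
  have hev : ∀ i, ∀ᶠ t : ℝ in nhdsWithin 0 (Set.Ioi 0), b i ≠ 0 → 0 < b i * (b i + t * d i) := by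
    intro i
    by_cases hi : b i = 0
    · simp [hi]
    · have hcont : Continuous fun t : ℝ => b i * (b i + t * d i) := by fun_prop
      have h0 : (0 : ℝ) < b i * (b i + 0 * d i) := by
        rw [zero_mul, add_zero]; exact mul_self_pos.2 hi
      have := (hcont.tendsto 0).eventually (lt_mem_nhds h0)
      exact (this.filter_mono nhdsWithin_le_nhds).mono fun t ht _ => ht
  obtain ⟨t, ht, ht0⟩ := ((eventually_all.2 hev).and self_mem_nhdsWithin).exists
  have ht0 : 0 < t := ht0
  have hdj : d j = g := by simp [hd, hc j hj]
  have hg2 : g * g = lam * lam := by rw [← abs_mul_abs_self, hE]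
  have hg0 : g ≠ 0 := by
    intro h0; rw [h0, abs_zero] at hE; exact hlam.ne hE
  have hfit : X.mulVec (b + t • d) = X.mulVec b := by
    rw [Matrix.mulVec_add, Matrix.mulVec_smul, hXd, smul_zero, add_zero]
  have hcorr : ∀ i, corr y X (b + t • d) i = corr y X b i := by
    intro i; simp only [corr, hfit]
  refine ⟨b + t • d, sol_of_kkt fun i => ?_, ?_⟩
  · rw [hcorr]
    refine ⟨(hk i).1, ?_⟩
    simp only [Pi.add_apply, Pi.smul_apply, smul_eq_mul]
    by_cases hi : b i = 0
    · by_cases hij : i = j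
      · subst hij
        rw [hj, hdj, zero_add, abs_mul, hE, abs_of_pos ht0, ← hg]
        linear_combination t * hg2
      · have : d i = 0 := by simp [hd, hc i hi, hij]
        simp [hi, this]
    · have h1 := ht i hi
      have h2 := (hk i).2
      rcases lt_or_gt_of_ne hi with hn | hp
      · have h3 : b i + t * d i < 0 := by
          by_contra! h3; nlinarith
        rw [abs_of_neg hn] at h2
        rw [abs_of_neg h3]
        have : corr y X b i = -lam := mul_right_cancel₀ hi (by linarith)
        rw [this]; ring
      · have h3 : 0 < b i + t * d i := by
          by_contra! h3; nlinarith
        rw [abs_of_pos hp] at h2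
        rw [abs_of_pos h3]
        have : corr y X b i = lam := mul_right_cancel₀ hi (by linarith)
        rw [this]
  · apply Finset.card_lt_card
    rw [Finset.ssubset_iff_of_subset]
    · refine ⟨j, ?_, ?_⟩
      · simp [spt, hj, hdj, ht0.ne', hg0]
      · simp [spt, hj]
    · intro i hi
      simp only [spt, Finset.mem_filter, Finset.mem_univ, true_and, Pi.add_apply,
        Pi.smul_apply, smul_eq_mul] at hi ⊢
      intro h0
      have := ht i hi
      rw [h0, mul_zero] at this
      exact lt_irrefl _ this

lemma exists_proj {n p : ℕ} (X : Matrix (Fin n) (Fin p) ℝ) (A : Finset (Fin p)) (j : Fin p) :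
    ∃ c : Fin p → ℝ, (∀ i, i ∉ A → c i = 0) ∧
      ∀ i, i ∈ A → ∑ k, X k i * X.mulVec (Pi.single j 1 - c) k = 0 := by
  let S : Submodule ℝ (Fin p → ℝ) :=
    { carrier := {c | ∀ i, i ∉ A → c i = 0}
      add_mem' := fun {a b} ha hb i hi => by simp [ha i hi, hb i hi]
      zero_mem' := fun i _ => rfl
      smul_mem' := fun r a ha i hi => by simp [ha i hi] }
  let L : (Fin p → ℝ) →ₗ[ℝ] EuclideanSpace ℝ (Fin n) :=
    (WithLp.linearEquiv 2 ℝ (Fin n → ℝ)).symm.toLinearMap ∘ₗ X.mulVecLin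
  let K := S.map L
  obtain ⟨c, hc, hcL⟩ : K.starProjection (L (Pi.single j 1)) ∈ S.map L :=
    Submodule.starProjection_apply_mem K _
  refine ⟨c, hc, fun i hi => ?_⟩
  have h1 : L (Pi.single j 1) - K.starProjection (L (Pi.single j 1)) ∈ Kᗮ :=
    Submodule.sub_starProjection_mem_orthogonal _
  have h2 : L (Pi.single i 1) ∈ K := by
    refine ⟨Pi.single i 1, fun k hk => ?_, rfl⟩
    have hki : k ≠ i := by
      rintro rfl
      exact hk hi
    exact Pi.single_eq_of_ne hki _
  have h3 := (Submodule.mem_orthogonal K _).1 h1 _ h2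
  rw [← hcL, ← map_sub] at h3
  rw [← h3]
  simp only [L, PiLp.inner_apply]
  refine Finset.sum_congr rfl fun k _ => ?_
  simp [mul_comm]

lemma hyper_null {n : ℕ} (z : Fin n → ℝ) (hz : z ≠ 0) (a : ℝ) :
    ∀ᵐ y ∂(volume : Measure (Fin n → ℝ)), ∑ k, z k * y k ≠ a := by
  let T : AffineSubspace ℝ (Fin n → ℝ) :=
    { carrier := {y | ∑ k, z k * y k = a}
      smul_vsub_vadd_mem' := by
        intro c p1 p2 p3 h1 h2 h3
        simp only [Set.mem_ofPred_eq] at *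
        simp only [vsub_eq_sub, vadd_eq_add, Pi.add_apply, Pi.smul_apply, Pi.sub_apply,
          smul_eq_mul, mul_add, mul_sub, Finset.sum_add_distrib, Finset.sum_sub_distrib,
          mul_left_comm _ c, ← Finset.mul_sum, h1, h2, h3]
        ring }
  have hT : T ≠ ⊤ := by
    intro h
    have hall : ∀ y : Fin n → ℝ, ∑ k, z k * y k = a := fun y => by
      have : y ∈ T := h ▸ AffineSubspace.mem_top ℝ _ y
      exact this
    have h0 := hall 0
    have h1 := hall z
    simp only [Pi.zero_apply, mul_zero, Finset.sum_const_zero] at h0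
    rw [← h0] at h1
    apply hz
    funext k
    have := (Finset.sum_eq_zero_iff_of_nonneg (fun k _ => mul_self_nonneg (z k))).1 h1 k
      (Finset.mem_univ k)
    simpa using this
  have := Measure.addHaar_affineSubspace (volume : Measure (Fin n → ℝ)) T hT
  rw [ae_iff]
  simp only [ne_eq, not_not]
  exact this


/-- For fixed X and λ > 0, for almost every y there is a lasso
solution whose support equals the equicorrelation set E; since every lasso
solution has support contained in E, it has the largest support. -/
theorem stmt16 {n p : ℕ} (X : Matrix (Fin n) (Fin p) ℝ) (lam : ℝ)
    (hlam : 0 < lam) :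
    ∀ᵐ y ∂(volume : Measure (Fin n → ℝ)),
      ∃ b : Fin p → ℝ, IsLassoSol y X lam b ∧
        {i : Fin p | b i ≠ 0} = {i : Fin p | i ∈ equiSet y X lam b} ∧
        ∀ b' : Fin p → ℝ, IsLassoSol y X lam b' →
          {i : Fin p | b' i ≠ 0} ⊆ {i : Fin p | i ∈ equiSet y X lam b} := by
  choose c hc hcA using fun (A : Finset (Fin p)) (j : Fin p) => exists_proj X A j
  have hae : ∀ᵐ y ∂(volume : Measure (Fin n → ℝ)), ∀ (A : Finset (Fin p)) (j : Fin p)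
      (s : Fin p → SignType), X.mulVec (Pi.single j 1 - c A j) ≠ 0 →
      ∑ k, X.mulVec (Pi.single j 1 - c A j) k * y k ≠
        ∑ i, ((s i : ℝ) * lam) * (Pi.single j 1 - c A j : Fin p → ℝ) i := by
    refine ae_all_iff.2 fun A => ae_all_iff.2 fun j => ae_all_iff.2 fun s => ?_
    by_cases hz : X.mulVec (Pi.single j 1 - c A j) = 0
    · simp [hz]
    · filter_upwards [hyper_null _ hz (∑ i, ((s i : ℝ) * lam) *
        (Pi.single j 1 - c A j : Fin p → ℝ) i)] with y hy _ using hy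
  filter_upwards [hae] with y hy
  have hmax : ∃ b, IsLassoSol y X lam b ∧
      ∀ b', IsLassoSol y X lam b' → (spt b').card ≤ (spt b).card := by
    obtain ⟨b0, hb0⟩ := exists_sol y X hlam
    have hfin : ((fun b : Fin p → ℝ => (spt b).card) '' {b | IsLassoSol y X lam b}).Finite := by
      refine (Set.finite_Iic p).subset ?_
      rintro _ ⟨b, _, rfl⟩
      simpa using Finset.card_le_univ (spt b)
    obtain ⟨m, hm⟩ := hfin.exists_maximal ⟨_, b0, hb0, rfl⟩
    obtain ⟨b, hb, rfl⟩ := hm.1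
    refine ⟨b, hb, fun b' hb' => ?_⟩
    by_contra! hlt
    exact absurd (hm.2 ⟨b', hb', rfl⟩ hlt.le) (not_le.2 hlt)
  obtain ⟨b, hb, hbmax⟩ := hmax
  have hsub : ∀ b' : Fin p → ℝ, IsLassoSol y X lam b' →
      {i : Fin p | b' i ≠ 0} ⊆ {i : Fin p | i ∈ equiSet y X lam b} := by
    intro b' hb' i hi
    simp only [equiSet, Set.mem_ofPred_eq, Finset.mem_filter, Finset.mem_univ, true_and]
    exact supp_sub hlam hb hb' i hi
  refine ⟨b, hb, Set.Subset.antisymm (hsub b hb) ?_, hsub⟩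
  intro j hj hbj
  simp only [equiSet, Set.mem_ofPred_eq, Finset.mem_filter, Finset.mem_univ, true_and] at hj
  have hcs : ∀ i, b i = 0 → c (spt b) j i = 0 := fun i hi => hc _ _ _ (by simp [spt, hi])
  by_cases hz : X.mulVec (Pi.single j 1 - c (spt b) j) = 0
  · obtain ⟨b', hb', hlt⟩ := enlarge hlam hb j hbj hj _ hcs hz
    exact absurd (hbmax b' hb') (not_le.2 hlt)
  · refine hy (spt b) j (fun i => SignType.sign (corr y X b i)) hz ?_
    have horth : ∑ k, X.mulVec b k * X.mulVec (Pi.single j 1 - c (spt b) j) k = 0 := by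
      have : ∀ i, b i * ∑ k, X k i * X.mulVec (Pi.single j 1 - c (spt b) j) k = 0 := by
        intro i
        by_cases hi : b i = 0
        · simp [hi]
        · rw [hcA (spt b) j i (by simp [spt, hi]), mul_zero]
      have h2 := Finset.sum_eq_zero (s := Finset.univ) (fun i _ => this i)
      rw [← h2]
      simp only [Finset.mul_sum]
      rw [Finset.sum_comm]
      refine Finset.sum_congr rfl fun k _ => ?_
      conv_lhs => rw [Matrix.mulVec, dotProduct, Finset.sum_mul]
      exact Finset.sum_congr rfl fun i _ => by ring
    have h1 := corr_dot y X b (Pi.single j 1 - c (spt b) j)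
    simp only [sub_mul, Finset.sum_sub_distrib, horth, sub_zero] at h1
    simp only [mul_comm _ (y _)]
    rw [← h1]
    refine Finset.sum_congr rfl fun i _ => ?_
    by_cases hi : |corr y X b i| = lam
    · rw [← hi, sign_mul_abs]
    · have hij : i ≠ j := fun h => hi (h ▸ hj)
      have hbi : b i = 0 := by
        by_contra h0
        exact hi (supp_sub hlam hb hb i h0)
      simp [hij, hcs i hbi]
end

section
/- Fix X ∈ ℝ^{n×p} and λ > 0. For Lebesgue-almost every y ∈ ℝⁿ, the following holds: if the lasso problem at y, X, λ has a unique solution, then the columns of X indexed by the equicorrelation set E are linearly independent, i.e., null(X_E) = {0}. -/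
open Matrix BigOperators Filter MeasureTheory

lemma aux_proj {n p : ℕ} (X : Matrix (Fin n) (Fin p) ℝ) (A : Finset (Fin p)) (i : Fin p) :
    ∃ c : Fin p → ℝ, (∀ k, k ∉ A → c k = 0) ∧
      ∀ k ∈ A, ∑ j, X j k * (X j i - X.mulVec c j) = 0 := by
  classical
  let u : Fin p → EuclideanSpace ℝ (Fin n) := fun k => WithLp.toLp 2 (fun j => X j k)
  let K : Submodule ℝ (EuclideanSpace ℝ (Fin n)) := Submodule.span ℝ (u '' (A : Set (Fin p)))
  obtain ⟨q, hq, z, hz, hqz⟩ := K.exists_add_mem_mem_orthogonal (u i)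
  obtain ⟨c, hc⟩ := (Submodule.mem_span_image_finset_iff_exists_fun ℝ).1 hq
  refine ⟨fun k => if h : k ∈ A then c ⟨k, h⟩ else 0, fun k hk => by simp [hk], fun k hk => ?_⟩
  have h1 : inner ℝ (u k) z = 0 :=
    (Submodule.mem_orthogonal K z).1 hz _ (Submodule.subset_span ⟨k, hk, rfl⟩)
  have h2 : ∀ j, z j = X j i - X.mulVec (fun k => if h : k ∈ A then c ⟨k, h⟩ else 0) j := by
    intro j
    have h3 : q j = X.mulVec (fun k => if h : k ∈ A then c ⟨k, h⟩ else 0) j := by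
      have e : X.mulVec (fun k => if h : k ∈ A then c ⟨k, h⟩ else 0) j
          = ∑ k : A, X j k * c k := by
        simp only [Matrix.mulVec, dotProduct]
        rw [← Finset.sum_subset (Finset.subset_univ A)
          (fun k _ hk => by simp [hk]), ← Finset.sum_coe_sort]
        exact Finset.sum_congr rfl fun k _ => by simp
      rw [e, ← hc]
      simp [u, mul_comm]
    have h4 : u i j = q j + z j := by rw [hqz]; rfl
    have h5 : u i j = X j i := rfl
    linarith
  rw [PiLp.inner_apply] at h1
  refine Eq.trans ?_ h1
  refine Finset.sum_congr rfl fun j _ => ?_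
  rw [← h2]
  simp [u, mul_comm]

lemma aux_null {n : ℕ} (w : Fin n → ℝ) (hw : w ≠ 0) (d : ℝ) :
    (volume : Measure (Fin n → ℝ)) {y | ∑ j, w j * y j = d} = 0 := by
  by_cases hne : ∃ y0 : Fin n → ℝ, ∑ j, w j * y0 j = d
  · obtain ⟨y0, h0⟩ := hne
    let L : (Fin n → ℝ) →ₗ[ℝ] ℝ :=
      { toFun := fun y => ∑ j, w j * y j
        map_add' := by intro a b; simp [mul_add, Finset.sum_add_distrib]
        map_smul' := by intro a b; simp [Finset.mul_sum, mul_left_comm] }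
    have hL : ∀ y, L y = ∑ j, w j * y j := fun _ => rfl
    have key := Measure.addHaar_affineSubspace (volume : Measure (Fin n → ℝ))
      (AffineSubspace.mk' y0 (LinearMap.ker L)) (by
        intro h
        have h1 : w +ᵥ y0 ∈ AffineSubspace.mk' y0 (LinearMap.ker L) := by
          rw [h]; exact AffineSubspace.mem_top ℝ _ _
        rw [AffineSubspace.mem_mk'] at h1
        simp only [vadd_vsub, LinearMap.mem_ker, hL] at h1
        exact hw (dotProduct_self_eq_zero.1 h1))
    refine measure_mono_null ?_ key
    intro y hy
    have hy' : ∑ j, w j * y j = d := hy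
    change y ∈ AffineSubspace.mk' y0 (LinearMap.ker L)
    rw [AffineSubspace.mem_mk', LinearMap.mem_ker, vsub_eq_sub, map_sub, hL, hL, hy', h0, sub_self]
  · have : {y : Fin n → ℝ | ∑ j, w j * y j = d} = ∅ := by
      ext y; simp only [Set.mem_ofPred_eq, Set.mem_empty_iff_false, iff_false]
      exact fun h => hne ⟨y, h⟩
    rw [this]; simp

lemma aux_quad (a C : ℝ) (h : ∀ t : ℝ, |t| ≤ 1 → 0 ≤ t * a + t ^ 2 * C) : a = 0 := by
  by_contra ha
  have hpos : 0 < |a| := abs_pos.2 ha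
  have hD : 0 < |a| + |C| := by positivity
  have h1 := h (-(a / (|a| + |C|) / 2)) (by
    rw [abs_neg, abs_div, abs_div, abs_of_pos hD, abs_of_pos (by norm_num : (0:ℝ) < 2),
      div_div, div_le_one (by positivity)]
    linarith [abs_nonneg C])
  have h2 : -(a / (|a| + |C|) / 2) * a + (-(a / (|a| + |C|) / 2)) ^ 2 * C
      = (a ^ 2 / (4 * (|a| + |C|) ^ 2)) * (C - 2 * (|a| + |C|)) := by
    field_simp; ring
  rw [h2] at h1
  have h3 : 0 < a ^ 2 / (4 * (|a| + |C|) ^ 2) := by positivity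
  nlinarith [le_abs_self C, abs_nonneg C]

lemma aux_swap {n p : ℕ} (y : Fin n → ℝ) (X : Matrix (Fin n) (Fin p) ℝ) (b c : Fin p → ℝ) :
    ∑ k, c k * corr y X b k = ∑ j, X.mulVec c j * (y j - X.mulVec b j) := by
  simp only [corr, Finset.mul_sum]
  rw [Finset.sum_comm]
  refine Finset.sum_congr rfl fun j _ => ?_
  have e : X.mulVec c j = ∑ k, X j k * c k := rfl
  rw [e, Finset.sum_mul]
  exact Finset.sum_congr rfl fun k _ => by ring

lemma aux_kkt {n p : ℕ} (y : Fin n → ℝ) (X : Matrix (Fin n) (Fin p) ℝ) (lam : ℝ)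
    (b : Fin p → ℝ) (hb : IsLassoSol y X lam b) (k : Fin p) :
    b k * corr y X b k = lam * |b k| := by
  classical
  let v : Fin p → ℝ := Pi.single k (b k)
  have hs := aux_swap y X b v
  have hs1 : ∑ i, v i * corr y X b i = b k * corr y X b k := by
    simp [v, Pi.single_apply]
  suffices h : lam * |b k| - b k * corr y X b k = 0 by linarith
  apply aux_quad _ ((1/2) * ∑ j, (X.mulVec v j) ^ 2)
  intro t ht
  have h := hb (b + t • v)
  unfold lassoObj at h
  have e1 : ∑ i, |(b + t • v) i| = ∑ i, |b i| + t * |b k| := by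
    rw [← Finset.add_sum_erase _ _ (Finset.mem_univ k),
      ← Finset.add_sum_erase (f := fun i => |b i|) _ (Finset.mem_univ k)]
    have : ∑ i ∈ Finset.univ.erase k, |(b + t • v) i| = ∑ i ∈ Finset.univ.erase k, |b i| := by
      refine Finset.sum_congr rfl fun i hi => ?_
      simp [v, Pi.single_apply, Finset.ne_of_mem_erase hi]
    rw [this]
    have h2 : |(b + t • v) k| = (1 + t) * |b k| := by
      have : (b + t • v) k = (1 + t) * b k := by simp [v]; ring
      rw [this, abs_mul, abs_of_nonneg (by linarith [(abs_le.1 ht).1])]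
    rw [h2]; ring
  have e2 : ∑ j, (y j - X.mulVec (b + t • v) j) ^ 2 = ∑ j, (y j - X.mulVec b j) ^ 2
      - 2 * t * ∑ j, X.mulVec v j * (y j - X.mulVec b j) + t ^ 2 * ∑ j, (X.mulVec v j) ^ 2 := by
    rw [Finset.mul_sum, Finset.mul_sum, ← Finset.sum_sub_distrib, ← Finset.sum_add_distrib]
    refine Finset.sum_congr rfl fun j _ => ?_
    rw [Matrix.mulVec_add, Matrix.mulVec_smul]
    simp only [Pi.add_apply, Pi.smul_apply, smul_eq_mul]
    ring
  rw [e1, e2, ← hs, hs1] at h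
  nlinarith

lemma aux_pert {n p : ℕ} (y : Fin n → ℝ) (X : Matrix (Fin n) (Fin p) ℝ) (lam : ℝ)
    (hlam : 0 < lam) (b : Fin p → ℝ) (hb : IsLassoSol y X lam b)
    (hu : ∀ b' : Fin p → ℝ, IsLassoSol y X lam b' → b' = b)
    (v : Fin p → ℝ) (hv : X.mulVec v = 0)
    (hE : ∀ k, v k ≠ 0 → |corr y X b k| = lam)
    (hsgn : ∀ k, b k = 0 → 0 ≤ v k * corr y X b k) : v = 0 := by
  have hbE : ∀ k, b k ≠ 0 → |corr y X b k| = lam := by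
    intro k hk
    have h := congrArg abs (aux_kkt y X lam b hb k)
    rw [abs_mul, abs_mul, abs_abs, abs_of_pos hlam, mul_comm] at h
    exact mul_right_cancel₀ (abs_ne_zero.2 hk) h
  have hev : ∀ k, ∀ᶠ t : ℝ in nhdsWithin 0 (Set.Ioi 0),
      lam * |b k + t * v k| = (b k + t * v k) * corr y X b k := by
    intro k
    have h0 : ∀ᶠ t : ℝ in nhdsWithin 0 (Set.Ioi 0), 0 ≤ (b k + t * v k) * corr y X b k := by
      by_cases hk : b k = 0
      · filter_upwards [self_mem_nhdsWithin] with t ht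
        have ht : 0 < t := ht
        rw [hk, zero_add, mul_assoc]
        exact mul_nonneg ht.le (hsgn k hk)
      · have hc : Continuous fun t : ℝ => (b k + t * v k) * corr y X b k := by fun_prop
        have hp : (0:ℝ) < (b k + 0 * v k) * corr y X b k := by
          rw [zero_mul, add_zero, aux_kkt y X lam b hb k]
          have := abs_pos.2 hk
          positivity
        have := (hc.tendsto 0).eventually (lt_mem_nhds hp)
        filter_upwards [nhdsWithin_le_nhds this] with t ht using le_of_lt ht
    filter_upwards [h0] with t ht
    by_cases hk : |corr y X b k| = lam
    · rw [← abs_of_nonneg ht, abs_mul, hk, mul_comm]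
    · have h1 : b k = 0 := by by_contra h; exact hk (hbE k h)
      have h2 : v k = 0 := by by_contra h; exact hk (hE k h)
      simp [h1, h2]
  have hall := eventually_all.2 hev
  obtain ⟨t, ht, htp⟩ := (hall.and self_mem_nhdsWithin).exists
  have htp : 0 < t := htp
  have hsum : lam * ∑ k, |(b + t • v) k| = lam * ∑ k, |b k| := by
    have e1 : lam * ∑ k, |(b + t • v) k|
        = ∑ k, b k * corr y X b k + t * ∑ k, v k * corr y X b k := by
      rw [Finset.mul_sum, Finset.mul_sum, ← Finset.sum_add_distrib]
      refine Finset.sum_congr rfl fun k _ => ?_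
      simp only [Pi.add_apply, Pi.smul_apply, smul_eq_mul]
      rw [ht k]; ring
    rw [e1, aux_swap y X b v, hv, Finset.mul_sum]
    simp only [aux_kkt y X lam b hb]
    simp [Finset.mul_sum]
  have hsol : IsLassoSol y X lam (b + t • v) := by
    intro β
    refine le_trans (le_of_eq ?_) (hb β)
    unfold lassoObj
    rw [hsum, Matrix.mulVec_add, Matrix.mulVec_smul, hv]
    simp
  have h := hu _ hsol
  have h' : t • v = 0 := by simpa using h
  exact (smul_eq_zero.1 h').resolve_left htp.ne'

/-- For fixed X and λ > 0, for almost every y: if the lasso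
solution is unique, then null(X_E) = {0}, i.e. the columns of X indexed by the
equicorrelation set E are linearly independent. -/
theorem stmt19 {n p : ℕ} (X : Matrix (Fin n) (Fin p) ℝ) (lam : ℝ)
    (hlam : 0 < lam) :
    ∀ᵐ y ∂(volume : Measure (Fin n → ℝ)),
      ∀ b : Fin p → ℝ, IsLassoSol y X lam b →
        (∀ b' : Fin p → ℝ, IsLassoSol y X lam b' → b' = b) →
        ∀ v : ↥(equiSet y X lam b) → ℝ,
          (colSub X (equiSet y X lam b)).mulVec v = 0 → v = 0 := by
  classical
  choose c hcA hcO using aux_proj X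
  let w : Finset (Fin p) → Fin p → Fin n → ℝ := fun A i j => X j i - X.mulVec (c A i) j
  have hae : ∀ᵐ y ∂(volume : Measure (Fin n → ℝ)), ∀ (A : Finset (Fin p)) (i : Fin p)
      (s : Fin p → SignType), w A i ≠ 0 →
        ∑ j, w A i j * y j ≠ lam * ((s i : ℝ) - ∑ k, c A i k * (s k : ℝ)) := by
    rw [ae_all_iff]; intro A
    rw [ae_all_iff]; intro i
    rw [ae_all_iff]; intro s
    by_cases hw : w A i = 0
    · simp [hw]
    · have h := aux_null (w A i) hw (lam * ((s i : ℝ) - ∑ k, c A i k * (s k : ℝ)))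
      rw [ae_iff]
      simpa [hw] using h
  filter_upwards [hae] with y hy b hb hu
  have hbE : ∀ k, b k ≠ 0 → |corr y X b k| = lam := by
    intro k hk
    have h := congrArg abs (aux_kkt y X lam b hb k)
    rw [abs_mul, abs_mul, abs_abs, abs_of_pos hlam, mul_comm] at h
    exact mul_right_cancel₀ (abs_ne_zero.2 hk) h
  have hsg : ∀ k, |corr y X b k| = lam →
      corr y X b k = lam * ((SignType.sign (corr y X b k) : SignType) : ℝ) := by
    intro k hk
    rw [← hk, mul_comm]
    exact (sign_mul_abs _).symm
  have hEA : ∀ i, |corr y X b i| = lam → b i ≠ 0 := by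
    intro i hi hbi
    let A : Finset (Fin p) := Finset.univ.filter fun k => b k ≠ 0
    have hA : ∀ k, k ∈ A ↔ b k ≠ 0 := by simp [A]
    have hci : ∀ k, b k = 0 → c A i k = 0 := fun k hk => hcA A i k (by simp [hA, hk])
    have hwb : ∑ j, w A i j * X.mulVec b j = 0 := by
      have : ∑ j, w A i j * X.mulVec b j = ∑ k, b k * ∑ j, X j k * w A i j := by
        simp only [Matrix.mulVec, dotProduct, Finset.mul_sum]
        rw [Finset.sum_comm]
        exact Finset.sum_congr rfl fun k _ => Finset.sum_congr rfl fun j _ => by ring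
      rw [this]
      refine Finset.sum_eq_zero fun k _ => ?_
      by_cases hk : b k = 0
      · simp [hk]
      · have := hcO A i k ((hA k).2 hk)
        change b k * ∑ j, X j k * (X j i - X.mulVec (c A i) j) = 0
        rw [this, mul_zero]
    have hwy : ∑ j, w A i j * y j = corr y X b i - ∑ k, c A i k * corr y X b k := by
      have e : ∑ j, w A i j * y j = ∑ j, w A i j * (y j - X.mulVec b j) := by
        simp only [mul_sub, Finset.sum_sub_distrib]
        rw [hwb, sub_zero]
      rw [e, aux_swap]
      unfold corr
      rw [← Finset.sum_sub_distrib]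
      exact Finset.sum_congr rfl fun j _ => by simp only [w]; ring
    have hw0 : w A i = 0 := by
      by_contra hw
      refine hy A i (fun k => SignType.sign (corr y X b k)) hw ?_
      rw [hwy, mul_sub, ← hsg i hi, Finset.mul_sum]
      congr 1
      refine Finset.sum_congr rfl fun k _ => ?_
      by_cases hk : b k = 0
      · simp [hci k hk]
      · rw [mul_left_comm, ← hsg k (hbE k hk)]
    have hX : X.mulVec (Pi.single i 1 - c A i) = 0 := by
      rw [Matrix.mulVec_sub]
      ext j
      have := congrFun hw0 j
      simpa [w] using this
    have hne : corr y X b i ≠ 0 := by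
      intro h; rw [h, abs_zero] at hi; exact hlam.ne hi
    have hv := aux_pert y X lam hlam b hb hu (corr y X b i • (Pi.single i 1 - c A i))
      (by rw [Matrix.mulVec_smul, hX, smul_zero])
      (by
        intro k hk
        by_cases hki : k = i
        · rw [hki]; exact hi
        · refine hbE k fun hbk => hk ?_
          simp [hki, hci k hbk])
      (by
        intro k hbk
        by_cases hki : k = i
        · subst hki
          simpa [hci k hbk] using mul_self_nonneg (corr y X b k)
        · simp [hki, hci k hbk])
    have := congrFun hv i
    simp [hci i hbi] at this
    exact hne this
  intro v hv
  have hmem : ∀ k, k ∈ equiSet y X lam b ↔ |corr y X b k| = lam := by simp [equiSet]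
  have hz := aux_pert y X lam hlam b hb hu
    (fun k => if h : k ∈ equiSet y X lam b then v ⟨k, h⟩ else 0)
    (by
      rw [← hv]
      ext j
      simp only [Matrix.mulVec, dotProduct, colSub]
      rw [← Finset.sum_subset (Finset.subset_univ (equiSet y X lam b))
        (fun k _ hk => by simp [hk]), ← Finset.sum_coe_sort]
      exact Finset.sum_congr rfl fun k _ => by simp)
    (by
      intro k hk
      by_contra h
      exact hk (by simp [hmem, h]))
    (by
      intro k hk
      have : k ∉ equiSet y X lam b := fun h => hEA k ((hmem k).1 h) hk
      simp [this])
  ext k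
  have := congrFun hz k.1
  simpa using this
end
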